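/- arXiv:2208.05883 — 2 statements merged into one kernel-verified Lean document; each statement's English description precedes it below -/
import Mathlib

section
/- Suppose β is a twice differentiable function satisfying 4[β'' /2·2 + ...], precisely: [2β'' + 12β² - 4(2n+λ)β + n(n+λ)]² = t²[(β')² + 4β³ - 2(2n+λ)β² + n(n+λ)β]. Then under the change of variables t = √2·z and β(t) = (2n+λ)/6 - v(z)/2, the function v satisfies the Chazy II equation (v'' - 6v² - α̃₁)² = z²((v')² - 4v³ - 2α̃₁v - β̃₁) with α̃₁ = -(2/3)(n² + nλ + λ²) and β̃₁ = -(4/27)(2n³ + 3n²λ - 3nλ² - 2λ³). -/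
open Real

theorem beta_to_chazyII
    (n lam : ℝ) (β : ℝ → ℝ)
    (hβ : ∀ t, DifferentiableAt ℝ β t)
    (hβ' : ∀ t, DifferentiableAt ℝ (deriv β) t)
    (heq : ∀ t, (2 * deriv (deriv β) t + 12 * β t ^ 2 - 4 * (2 * n + lam) * β t
        + n * (n + lam)) ^ 2
      = t ^ 2 * ((deriv β t) ^ 2 + 4 * β t ^ 3 - 2 * (2 * n + lam) * β t ^ 2
        + n * (n + lam) * β t))
    (v : ℝ → ℝ)
    (hv : ∀ z, v z = (2 * n + lam) / 3 - 2 * β (Real.sqrt 2 * z)) :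
    ∀ z, (deriv (deriv v) z - 6 * v z ^ 2
        - (-(2 / 3) * (n ^ 2 + n * lam + lam ^ 2))) ^ 2
      = z ^ 2 * ((deriv v z) ^ 2 - 4 * v z ^ 3
        - 2 * (-(2 / 3) * (n ^ 2 + n * lam + lam ^ 2)) * v z
        - (-(4 / 27) * (2 * n ^ 3 + 3 * n ^ 2 * lam - 3 * n * lam ^ 2
            - 2 * lam ^ 3))) := by
  intro z
  have hscale (w : ℝ) : HasDerivAt (fun x : ℝ => √2 * x) √2 w := by
    simpa using (hasDerivAt_id w).const_mul √2
  have hsq : √2 ^ 2 = (2 : ℝ) := Real.sq_sqrt (by norm_num)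
  have hv_deriv : deriv v = fun w => -(2 * √2) * deriv β (√2 * w) := by
    funext w
    rw [funext hv]
    refine ((((hβ (√2 * w)).hasDerivAt.comp w (hscale w)).const_mul 2).const_sub
      ((2 * n + lam) / 3)).deriv.trans ?_
    ring
  have hv_deriv2 : deriv (deriv v) z = -4 * deriv (deriv β) (√2 * z) := by
    rw [hv_deriv]
    refine (((hβ' (√2 * z)).hasDerivAt.comp z (hscale z)).const_mul (-(2 * √2))).deriv.trans ?_
    linear_combination -2 * deriv (deriv β) (√2 * z) * hsq
  have hβz := heq (√2 * z)
  rw [mul_pow, hsq] at hβz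
  rw [hv_deriv2, hv_deriv, hv z]
  linear_combination 4 * hβz - 4 * z ^ 2 * deriv β (√2 * z) ^ 2 * hsq
end

section
/- Let q(s) satisfy the Painlevé IV equation q'' = (q')²/(2q) + (3/2)q³ + 4sq² + 2(s² - 2n - 1 - λ)q - 2λ²/q with q nonvanishing, and define v(z) = (1/4)q'(s) + (1/4)q(s)² + (1/2)s q(s) - n/3 - λ/6 where z = √2·s. Then v satisfies the Chazy II equation (v'' - 6v² - α̃₁)² = z²((v')² - 4v³ - 2α̃₁v - β̃₁), where α̃₁ = -(2/3)(n² + nλ + λ²) and β̃₁ = -(4/27)(2n³ + 3n²λ - 3nλ² - 2λ³), and derivatives of v are with respect to z. -/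
open Real

/-- With `A = q' + q² + 2sq`, Painlevé IV becomes a first-order equation for `A`. -/
lemma painleveIV_hasDerivAt_riccati {n lam : ℝ} {q : ℝ → ℝ}
    (hq : ∀ s, DifferentiableAt ℝ q s)
    (hq' : ∀ s, DifferentiableAt ℝ (deriv q) s)
    (hqne : ∀ s, q s ≠ 0)
    (hp4 : ∀ s, deriv (deriv q) s
      = (deriv q s) ^ 2 / (2 * q s) + (3 / 2) * q s ^ 3 + 4 * s * q s ^ 2
        + 2 * (s ^ 2 - 2 * n - 1 - lam) * q s - 2 * lam ^ 2 / q s)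
    {A : ℝ → ℝ} (hA : ∀ s, A s = deriv q s + q s ^ 2 + 2 * s * q s) (s : ℝ) :
    HasDerivAt A
      (((A s ^ 2 - 4 * lam ^ 2) / q s + (2 * A s - 8 * n - 4 * lam) * q s) / 2) s := by
  have h := ((hq' s).hasDerivAt.add ((hq s).hasDerivAt.pow 2)).add
    (((hasDerivAt_id s).const_mul 2).mul (hq s).hasDerivAt)
  have hq0 := hqne s
  refine (h.congr_deriv ?_).congr_of_eventuallyEq (.of_forall hA)
  rw [hp4, hA]
  simp only [id_eq]
  field_simp
  ring

/-- Rescaling the independent variable by `√2` divides the derivative by `√2`. -/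
lemma HasDerivAt.comp_div_sqrt_two {f : ℝ → ℝ} {f' z : ℝ}
    (h : HasDerivAt f f' (z / √2)) :
    HasDerivAt (fun z => f (z / √2)) (f' / √2) z := by
  simpa [Function.comp_def, div_eq_mul_inv] using h.comp z ((hasDerivAt_id z).div_const √2)

theorem painleveIV_to_chazyII
    (n lam : ℝ) (q : ℝ → ℝ)
    (hq : ∀ s, DifferentiableAt ℝ q s)
    (hq' : ∀ s, DifferentiableAt ℝ (deriv q) s)
    (hqne : ∀ s, q s ≠ 0)
    (hp4 : ∀ s, deriv (deriv q) s
      = (deriv q s) ^ 2 / (2 * q s) + (3 / 2) * q s ^ 3 + 4 * s * q s ^ 2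
        + 2 * (s ^ 2 - 2 * n - 1 - lam) * q s - 2 * lam ^ 2 / q s)
    (v : ℝ → ℝ)
    (hv : ∀ z, v z = (1 / 4) * deriv q (z / Real.sqrt 2)
        + (1 / 4) * (q (z / Real.sqrt 2)) ^ 2
        + (z / (2 * Real.sqrt 2)) * q (z / Real.sqrt 2) - n / 3 - lam / 6) :
    ∀ z, (deriv (deriv v) z - 6 * v z ^ 2
        - (-(2 / 3) * (n ^ 2 + n * lam + lam ^ 2))) ^ 2
      = z ^ 2 * ((deriv v z) ^ 2 - 4 * v z ^ 3
        - 2 * (-(2 / 3) * (n ^ 2 + n * lam + lam ^ 2)) * v z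
        - (-(4 / 27) * (2 * n ^ 3 + 3 * n ^ 2 * lam - 3 * n * lam ^ 2
            - 2 * lam ^ 3))) := by
  have hr2 : √2 ^ 2 = 2 := Real.sq_sqrt (by norm_num)
  obtain ⟨A, hA⟩ : ∃ A : ℝ → ℝ, ∀ s, A s = deriv q s + q s ^ 2 + 2 * s * q s :=
    ⟨_, fun _ => rfl⟩
  have hdA := painleveIV_hasDerivAt_riccati hq hq' hqne hp4 hA
  obtain ⟨B, hB⟩ : ∃ B : ℝ → ℝ, ∀ s, B s =
      ((A s ^ 2 - 4 * lam ^ 2) / q s + (2 * A s - 8 * n - 4 * lam) * q s) / 2 :=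
    ⟨_, fun _ => rfl⟩
  simp only [← hB] at hdA
  have hvA : v = fun z => A (z / √2) / 4 - n / 3 - lam / 6 := by
    funext z
    rw [hv, hA]
    field_simp
    ring
  have hdv : deriv v = fun z => B (z / √2) / √2 / 4 := by
    funext z
    rw [hvA]
    exact ((((hdA _).comp_div_sqrt_two.div_const 4).sub_const _).sub_const _).deriv
  have hdB (s : ℝ) : HasDerivAt B
      (((2 * A s * B s * q s - (A s ^ 2 - 4 * lam ^ 2) * deriv q s) / q s ^ 2
        + (2 * B s * q s + (2 * A s - 8 * n - 4 * lam) * deriv q s)) / 2) s := by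
    have h := (((((hdA s).pow 2).sub_const (4 * lam ^ 2)).div (hq s).hasDerivAt (hqne s)).add
      (((((hdA s).const_mul 2).sub_const (8 * n)).sub_const (4 * lam)).mul
        (hq s).hasDerivAt)).div_const 2
    refine (h.congr_deriv ?_).congr_of_eventuallyEq (.of_forall hB)
    simp
  intro z
  have hddv := (((hdB (z / √2)).comp_div_sqrt_two.div_const √2).div_const 4).deriv
  rw [← hdv] at hddv
  obtain ⟨s, rfl⟩ : ∃ s, z = √2 * s := ⟨z / √2, by field_simp⟩
  have hs : √2 * s / √2 = s := by field_simp
  have hp : deriv q s = A s - q s ^ 2 - 2 * s * q s := by rw [hA]; ring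
  have hq0 := hqne s
  rw [hddv, hdv, hvA]
  simp only [hs, div_div _ √2 √2, ← sq, hr2, hp, mul_pow, div_pow, hB]
  field_simp
  ring
end
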